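/- Suppose Assumption 1 holds and items (i) and (iii) of Assumption 3 hold; let Γ̄ = diag(γ̄₁,…,γ̄_p) be a positive diagonal matrix with Γ̄CB + (CB)ᵀΓ̄ positive definite, let λ₁ > 0 be the smallest eigenvalue of Γ̄CB + (CB)ᵀΓ̄ and λ₂ := ‖Γ̄CA‖ (spectral norm), and let ν, c > 0 be such that |u| ≥ c for every u ∈ −ΨΨ(y) whenever 0 < |y| ≤ ν. Define W(y) := 2 Σᵢ γ̄ᵢ ∫₀^{yᵢ} ψᵢ(σ) dσ. Then there exist μ ∈ (0, ν] and class-K∞ functions α₄, α₅ such that ω := λ₁(c − 2μλ₂/λ₁) > 0, α₄(|Cx|) ≤ W(Cx) ≤ α₅(|Cx|) for all x with |x| ≤ μ, and for every x with |x| ≤ μ and Cx ≠ 0, every element a of the set-valued Lie derivative D̄W_F(x) satisfies a ≤ −cω. -/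

import Mathlib

open Matrix MeasureTheory Filter Set
open scoped ENNReal

noncomputable section

/-- Euclidean norm on `Fin m → ℝ`. -/
def euclNorm {m : ℕ} (x : Fin m → ℝ) : ℝ := Real.sqrt (∑ i, x i ^ 2)

/-- Krasovskii regularization of a scalar function `ψ` at `y`:
`Ψ(y) = ⋂_{δ>0} closure (convexHull (ψ '' [y-δ, y+δ]))`. -/
def kras (ψ : ℝ → ℝ) (y : ℝ) : Set ℝ :=
  ⋂ δ ∈ Set.Ioi (0 : ℝ), closure (convexHull ℝ (ψ '' Set.Icc (y - δ) (y + δ)))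

/-- Product (decentralized) Krasovskii regularization `ΨΨ(y) = Ψ₁(y₁) × ⋯ × Ψ_p(y_p)`. -/
def PsiSet {p : ℕ} (ψ : Fin p → ℝ → ℝ) (y : Fin p → ℝ) : Set (Fin p → ℝ) :=
  {w | ∀ i, w i ∈ kras (ψ i) (y i)}

/-- The regularized Lur'e set-valued dynamics `F(x) = {Ax + Bu : u ∈ -ΨΨ(Cx)}`. -/
def lureF {n p : ℕ} (A : Matrix (Fin n) (Fin n) ℝ) (B : Matrix (Fin n) (Fin p) ℝ)
    (C : Matrix (Fin p) (Fin n) ℝ) (ψ : Fin p → ℝ → ℝ) (x : Fin n → ℝ) :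
    Set (Fin n → ℝ) :=
  {f | ∃ u : Fin p → ℝ, (fun i => -u i) ∈ PsiSet ψ (C.mulVec x) ∧
        f = A.mulVec x + B.mulVec u}

/-- Piecewise continuity: finitely many discontinuity points on every compact
interval, and finite one-sided limits at every point. -/
def PiecewiseContinuous (f : ℝ → ℝ) : Prop :=
  (∀ a b : ℝ, {s ∈ Set.Icc a b | ¬ ContinuousAt f s}.Finite) ∧
  (∀ x : ℝ, (∃ L : ℝ, Tendsto f (nhdsWithin x (Set.Ioi x)) (nhds L)) ∧
    (∃ L : ℝ, Tendsto f (nhdsWithin x (Set.Iio x)) (nhds L)))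

/-- Sector condition: there is `ζ = 1/z ∈ (0, +∞]` (with `z = ζ⁻¹ ≥ 0`, `z = 0`
corresponding to `ζ = +∞`) such that `ψ(s)(ψ(s) - ζ s) ≤ 0` for all `s`. -/
def Sector (ψ : ℝ → ℝ) (z : ℝ) : Prop :=
  (z = 0 ∧ ∀ s : ℝ, 0 ≤ s * ψ s) ∨
  (0 < z ∧ ∀ s : ℝ, ψ s * (ψ s - (1 / z) * s) ≤ 0)

/-- Class `KL` functions. -/
def ClassKL (β : ℝ → ℝ → ℝ) : Prop :=
  (∀ t : ℝ, 0 ≤ t → ContinuousOn (fun s => β s t) (Set.Ici 0) ∧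
    StrictMonoOn (fun s => β s t) (Set.Ici 0) ∧ β 0 t = 0) ∧
  (∀ s : ℝ, 0 ≤ s → AntitoneOn (fun t => β s t) (Set.Ici 0) ∧
    Tendsto (fun t => β s t) atTop (nhds 0))

/-- Class `K∞` functions. -/
def ClassKInf (α : ℝ → ℝ) : Prop :=
  ContinuousOn α (Set.Ici 0) ∧ StrictMonoOn α (Set.Ici 0) ∧ α 0 = 0 ∧
  Tendsto α atTop atTop

/-- A Krasovskii solution of `ẋ ∈ F(x)` on a time set `s` (a locally absolutely
continuous function whose derivative belongs to `F(x(t))` almost everywhere),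
formalized through the integral representation `x(t) = x(0) + ∫₀ᵗ f(τ) dτ`
with `f(τ) ∈ F(x(τ))` for a.e. `τ ∈ s`. -/
def IsKrasovskiiSolutionOn {n : ℕ} (F : (Fin n → ℝ) → Set (Fin n → ℝ))
    (x : ℝ → Fin n → ℝ) (s : Set ℝ) : Prop :=
  ∃ f : ℝ → Fin n → ℝ,
    (∀ t ∈ s, IntervalIntegrable f volume 0 t) ∧
    (∀ᵐ t ∂volume, t ∈ s → f t ∈ F (x t)) ∧
    ∀ t ∈ s, x t = x 0 + ∫ τ in (0:ℝ)..t, f τ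

/-- The time interval `[0, T)` with `T ∈ (0, +∞]`. -/
def timeItv (T : ℝ≥0∞) : Set ℝ := {t : ℝ | 0 ≤ t ∧ ENNReal.ofReal t < T}

/-- Global asymptotic stability of the origin: a class-`KL` bound holds along
every Krasovskii solution on every time interval `[0, T)`. -/
def GASOrigin {n p : ℕ} (A : Matrix (Fin n) (Fin n) ℝ) (B : Matrix (Fin n) (Fin p) ℝ)
    (C : Matrix (Fin p) (Fin n) ℝ) (ψ : Fin p → ℝ → ℝ) : Prop :=
  ∃ β : ℝ → ℝ → ℝ, ClassKL β ∧
    ∀ T : ℝ≥0∞, ∀ x : ℝ → Fin n → ℝ,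
      IsKrasovskiiSolutionOn (lureF A B C ψ) x (timeItv T) →
      ∀ t ∈ timeItv T, euclNorm (x t) ≤ β (euclNorm (x 0)) t

/-- The auxiliary function `W(y) = 2 Σᵢ γ̄ᵢ ∫₀^{yᵢ} ψᵢ(σ) dσ`. -/
def Wfun {p : ℕ} (γb : Fin p → ℝ) (ψ : Fin p → ℝ → ℝ) (y : Fin p → ℝ) : ℝ :=
  2 * ∑ i, γb i * ∫ σ in (0:ℝ)..(y i), ψ i σ

/-- Set-valued Lie derivative of `x ↦ W(Cx)` along the regularized Lur'e
dynamics, using the Clarke gradient `∂(W∘C)(x) = {2CᵀΓ̄w : w ∈ ΨΨ(Cx)}`. -/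
def lieDerivW {n p : ℕ} (A : Matrix (Fin n) (Fin n) ℝ) (B : Matrix (Fin n) (Fin p) ℝ)
    (C : Matrix (Fin p) (Fin n) ℝ) (ψ : Fin p → ℝ → ℝ) (γb : Fin p → ℝ)
    (x : Fin n → ℝ) : Set ℝ :=
  {a | ∃ f ∈ lureF A B C ψ x, ∀ w ∈ PsiSet ψ (C.mulVec x),
        ((2 : ℝ) • (Cᵀ * Matrix.diagonal γb).mulVec w) ⬝ᵥ f = a}

lemma integral_bounds_of_finite_discontinuities {f : ℝ → ℝ} {a b m M : ℝ} (hab : a ≤ b)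
    (hfin : {s ∈ Set.Icc a b | ¬ ContinuousAt f s}.Finite)
    (hf : ∀ s ∈ Set.Ioo a b, m ≤ f s ∧ f s ≤ M) :
    m * (b - a) ≤ ∫ s in a..b, f s ∧ ∫ s in a..b, f s ≤ M * (b - a) := by
  have hae : Set.Ioo a b \ {s ∈ Set.Icc a b | ¬ ContinuousAt f s} =ᵐ[volume] Set.Ioo a b :=
    sdiff_null_ae_eq_self (hfin.measure_zero _)
  have hmeas : AEStronglyMeasurable f (volume.restrict (Set.Ioo a b)) := by
    rw [← Measure.restrict_congr_set hae]
    refine ContinuousOn.aestronglyMeasurable (fun s hs => ?_)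
      (measurableSet_Ioo.diff hfin.measurableSet)
    by_contra hcont
    exact hs.2 ⟨Set.Ioo_subset_Icc_self hs.1, fun h => hcont h.continuousWithinAt⟩
  have hint : IntervalIntegrable f volume a b := by
    rw [intervalIntegrable_iff_integrableOn_Ioo_of_le hab]
    refine Integrable.of_bound hmeas (max |m| |M|) ?_
    filter_upwards [ae_restrict_mem measurableSet_Ioo] with s hs
    exact abs_le_max_abs_abs (hf s hs).1 (hf s hs).2
  constructor
  · have h := intervalIntegral.integral_mono_on_of_le_Ioo hab
      (intervalIntegrable_const (c := m)) hint (fun s hs => (hf s hs).1)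
    rwa [intervalIntegral.integral_const, smul_eq_mul, mul_comm] at h
  · have h := intervalIntegral.integral_mono_on_of_le_Ioo hab hint
      (intervalIntegrable_const (c := M)) (fun s hs => (hf s hs).2)
    rwa [intervalIntegral.integral_const, smul_eq_mul, mul_comm M] at *

lemma exists_linear_bounds_integral {f : ℝ → ℝ} (hpc : PiecewiseContinuous f)
    (hpos : ∃ L : ℝ, 0 < L ∧ Tendsto f (nhdsWithin 0 (Set.Ioi 0)) (nhds L))
    (hneg : ∃ L : ℝ, L < 0 ∧ Tendsto f (nhdsWithin 0 (Set.Iio 0)) (nhds L)) :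
    ∃ m M d : ℝ, 0 < m ∧ 0 < M ∧ 0 < d ∧ ∀ y : ℝ, |y| ≤ d →
      m * |y| ≤ ∫ s in (0:ℝ)..y, f s ∧ ∫ s in (0:ℝ)..y, f s ≤ M * |y| := by
  obtain ⟨L, hL, hLt⟩ := hpos
  obtain ⟨N, hN, hNt⟩ := hneg
  have h1 := hLt.eventually (Icc_mem_nhds (show L / 2 < L by linarith) (show L < 2 * L by linarith))
  have h2 := hNt.eventually (Icc_mem_nhds (show 2 * N < N by linarith) (show N < N / 2 by linarith))
  obtain ⟨b, hb, hbs⟩ := mem_nhdsGT_iff_exists_Ioo_subset.1 h1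
  obtain ⟨a, ha, has⟩ := mem_nhdsLT_iff_exists_Ioo_subset.1 h2
  simp only [Set.mem_Ioi, Set.mem_Iio] at ha hb
  refine ⟨min (L / 2) (-N / 2), max (2 * L) (-2 * N), min b (-a),
    lt_min (by linarith) (by linarith), lt_max_of_lt_left (by linarith),
    lt_min hb (by linarith), fun y hy => ?_⟩
  have hyb := hy.trans (min_le_left _ _)
  have hya := hy.trans (min_le_right _ _)
  rcases le_total 0 y with h0 | h0
  · rw [abs_of_nonneg h0] at *
    have h := integral_bounds_of_finite_discontinuities (f := f) (m := L / 2) (M := 2 * L) h0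
      (hpc.1 0 y) (fun s hs => hbs ⟨hs.1, hs.2.trans_le hyb⟩)
    rw [sub_zero] at h
    exact ⟨(mul_le_mul_of_nonneg_right (min_le_left _ _) h0).trans h.1,
      h.2.trans (mul_le_mul_of_nonneg_right (le_max_left _ _) h0)⟩
  · rw [abs_of_nonpos h0] at *
    have h := integral_bounds_of_finite_discontinuities (f := f) (m := 2 * N) (M := N / 2) h0
      (hpc.1 y 0) (fun s hs => has ⟨by linarith [hs.1], hs.2⟩)
    have h0' : 0 ≤ -y := by linarith
    rw [intervalIntegral.integral_symm]
    have e1 := mul_le_mul_of_nonneg_right (min_le_right (L / 2) (-N / 2)) h0'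
    have e2 := mul_le_mul_of_nonneg_right (le_max_right (2 * L) (-2 * N)) h0'
    constructor <;> linarith [h.1, h.2]

lemma euclNorm_nonneg {m : ℕ} (x : Fin m → ℝ) : 0 ≤ euclNorm x := Real.sqrt_nonneg _

lemma dotProduct_self_eq_euclNorm_sq {m : ℕ} (x : Fin m → ℝ) : x ⬝ᵥ x = euclNorm x ^ 2 := by
  rw [euclNorm, Real.sq_sqrt (Finset.sum_nonneg fun i _ => sq_nonneg _)]
  simp [dotProduct, sq]

lemma euclNorm_pos {m : ℕ} {x : Fin m → ℝ} (hx : x ≠ 0) : 0 < euclNorm x := by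
  refine (euclNorm_nonneg x).lt_of_ne fun h => hx ?_
  rw [← dotProduct_self_eq_zero, dotProduct_self_eq_euclNorm_sq, ← h]
  simp

lemma euclNorm_neg {m : ℕ} (x : Fin m → ℝ) : euclNorm (-x) = euclNorm x := by
  simp [euclNorm]

lemma dotProduct_le_euclNorm_mul {m : ℕ} (x y : Fin m → ℝ) :
    x ⬝ᵥ y ≤ euclNorm x * euclNorm y :=
  Real.sum_mul_le_sqrt_mul_sqrt _ _ _

lemma abs_apply_le_euclNorm {m : ℕ} (x : Fin m → ℝ) (i : Fin m) : |x i| ≤ euclNorm x :=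
  Real.abs_le_sqrt (Finset.single_le_sum (f := fun i => x i ^ 2)
    (fun j _ => sq_nonneg (x j)) (Finset.mem_univ i))

lemma euclNorm_le_sum_abs {m : ℕ} (x : Fin m → ℝ) : euclNorm x ≤ ∑ i, |x i| := by
  refine Real.sqrt_le_iff.2 ⟨Finset.sum_nonneg fun i _ => abs_nonneg _, ?_⟩
  simpa using Finset.sum_sq_le_sq_sum_of_nonneg (s := Finset.univ) (f := fun i => |x i|)
    (fun i _ => abs_nonneg _)

lemma euclNorm_mulVec_le {m n : ℕ} (C : Matrix (Fin m) (Fin n) ℝ) (x : Fin n → ℝ) :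
    euclNorm (C.mulVec x) ≤ (∑ i, ∑ j, |C i j|) * euclNorm x := by
  refine (euclNorm_le_sum_abs _).trans ?_
  rw [Finset.sum_mul]
  refine Finset.sum_le_sum fun i _ => ?_
  rw [Finset.sum_mul]
  refine (Finset.abs_sum_le_sum_abs (fun j => C i j * x j) Finset.univ).trans
    (Finset.sum_le_sum fun j _ => ?_)
  rw [abs_mul]
  exact mul_le_mul_of_nonneg_left (abs_apply_le_euclNorm x j) (abs_nonneg _)

lemma classKInf_const_mul {k : ℝ} (hk : 0 < k) : ClassKInf fun r => k * r :=
  ⟨by fun_prop, (strictMono_mul_left_of_pos hk).strictMonoOn _, mul_zero k,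
    tendsto_id.const_mul_atTop hk⟩

lemma exists_linear_bounds_Wfun {p : ℕ} {ψ : Fin p → ℝ → ℝ} {γb : Fin p → ℝ}
    (hγb : ∀ i, 0 < γb i)
    (hψ : ∀ i, ∃ m M d : ℝ, 0 < m ∧ 0 < M ∧ 0 < d ∧ ∀ y : ℝ, |y| ≤ d →
      m * |y| ≤ ∫ s in (0:ℝ)..y, ψ i s ∧ ∫ s in (0:ℝ)..y, ψ i s ≤ M * |y|) :
    ∃ k K d : ℝ, 0 < k ∧ 0 < K ∧ 0 < d ∧ ∀ y : Fin p → ℝ, euclNorm y ≤ d →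
      k * euclNorm y ≤ Wfun γb ψ y ∧ Wfun γb ψ y ≤ K * euclNorm y := by
  choose m M d hm hM hd h using hψ
  have hsmall : ∀ᶠ t in nhdsWithin (0:ℝ) (Set.Ioi 0), ∀ i, t ≤ γb i * m i ∧ t ≤ d i :=
    eventually_all.2 fun i =>
      (eventually_nhdsWithin_of_eventually_nhds (eventually_le_nhds (mul_pos (hγb i) (hm i)))).and
        (eventually_nhdsWithin_of_eventually_nhds (eventually_le_nhds (hd i)))
  obtain ⟨t, ht, ht0⟩ := (hsmall.and self_mem_nhdsWithin).exists
  have ht0 : 0 < t := ht0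
  have hS : 0 ≤ ∑ i, γb i * M i := Finset.sum_nonneg fun i _ => (mul_pos (hγb i) (hM i)).le
  refine ⟨2 * t, 2 * (∑ i, γb i * M i) + 1, t, by positivity, by positivity, ht0,
    fun y hy => ?_⟩
  have hyi : ∀ i, |y i| ≤ d i := fun i => (abs_apply_le_euclNorm y i).trans (hy.trans (ht i).2)
  constructor
  · rw [Wfun, mul_assoc]
    refine mul_le_mul_of_nonneg_left ?_ zero_le_two
    refine (mul_le_mul_of_nonneg_left (euclNorm_le_sum_abs y) ht0.le).trans ?_
    rw [Finset.mul_sum]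
    refine Finset.sum_le_sum fun i _ => ?_
    calc t * |y i| ≤ γb i * m i * |y i| := mul_le_mul_of_nonneg_right (ht i).1 (abs_nonneg _)
      _ = γb i * (m i * |y i|) := mul_assoc _ _ _
      _ ≤ _ := mul_le_mul_of_nonneg_left (h i _ (hyi i)).1 (hγb i).le
  · have hsum : ∑ i, γb i * ∫ σ in (0:ℝ)..(y i), ψ i σ ≤ (∑ i, γb i * M i) * euclNorm y := by
      rw [Finset.sum_mul]
      refine Finset.sum_le_sum fun i _ => ?_
      calc _ ≤ γb i * (M i * |y i|) := mul_le_mul_of_nonneg_left (h i _ (hyi i)).2 (hγb i).le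
        _ = γb i * M i * |y i| := (mul_assoc _ _ _).symm
        _ ≤ _ := mul_le_mul_of_nonneg_left (abs_apply_le_euclNorm y i)
          (mul_pos (hγb i) (hM i)).le
    rw [Wfun]
    linarith [euclNorm_nonneg y]

lemma two_smul_gradient_dotProduct {n p : ℕ} (A : Matrix (Fin n) (Fin n) ℝ)
    (B : Matrix (Fin n) (Fin p) ℝ) (C : Matrix (Fin p) (Fin n) ℝ) (γb : Fin p → ℝ)
    (x : Fin n → ℝ) (u : Fin p → ℝ) :
    ((2 : ℝ) • (Cᵀ * Matrix.diagonal γb).mulVec (-u)) ⬝ᵥ (A.mulVec x + B.mulVec u) =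
      2 * ((-u) ⬝ᵥ (Matrix.diagonal γb * C * A).mulVec x) -
        u ⬝ᵥ ((Matrix.diagonal γb * (C * B) + (C * B)ᵀ * Matrix.diagonal γb).mulVec u) := by
  have hgrad : ∀ v : Fin n → ℝ, (Cᵀ * Matrix.diagonal γb).mulVec (-u) ⬝ᵥ v =
      (-u) ⬝ᵥ (Matrix.diagonal γb * C).mulVec v := fun v => by
    rw [dotProduct_mulVec, ← mulVec_transpose, transpose_mul, diagonal_transpose]
  have hsymm : u ⬝ᵥ ((C * B)ᵀ * Matrix.diagonal γb).mulVec u =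
      u ⬝ᵥ (Matrix.diagonal γb * (C * B)).mulVec u := by
    rw [dotProduct_mulVec, ← mulVec_transpose, transpose_mul, diagonal_transpose,
      transpose_transpose, dotProduct_comm]
  rw [smul_dotProduct, hgrad, mulVec_add, dotProduct_add, mulVec_mulVec, mulVec_mulVec,
    add_mulVec, dotProduct_add, hsymm, ← Matrix.mul_assoc, neg_dotProduct, neg_dotProduct,
    smul_eq_mul]
  ring

lemma le_of_mem_lieDerivW {n p : ℕ} {A : Matrix (Fin n) (Fin n) ℝ}
    {B : Matrix (Fin n) (Fin p) ℝ} {C : Matrix (Fin p) (Fin n) ℝ} {ψ : Fin p → ℝ → ℝ}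
    {γb : Fin p → ℝ} {lam1 lam2 c μ : ℝ} {x : Fin n → ℝ} {a : ℝ}
    (hlam1pos : 0 < lam1)
    (hlam1 : ∀ u : Fin p → ℝ,
      lam1 * (u ⬝ᵥ u) ≤
        u ⬝ᵥ ((Matrix.diagonal γb * (C * B) + (C * B)ᵀ * Matrix.diagonal γb).mulVec u))
    (hlam2nonneg : 0 ≤ lam2)
    (hlam2 : ∀ v : Fin n → ℝ,
      euclNorm ((Matrix.diagonal γb * C * A).mulVec v) ≤ lam2 * euclNorm v)
    (hμc : 2 * μ * lam2 < lam1 * c) (hx : euclNorm x ≤ μ)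
    (hcx : ∀ u : Fin p → ℝ, (fun i => -u i) ∈ PsiSet ψ (C.mulVec x) → c ≤ euclNorm u)
    (ha : a ∈ lieDerivW A B C ψ γb x) :
    a ≤ -(c * (lam1 * (c - 2 * μ * lam2 / lam1))) := by
  obtain ⟨f, ⟨u, hu, rfl⟩, hf⟩ := ha
  have hcu := hcx u hu
  have hau := (hf (-u) hu).symm.trans (two_smul_gradient_dotProduct A B C γb x u)
  have hq := hlam1 u
  rw [dotProduct_self_eq_euclNorm_sq] at hq
  have hcross : (-u) ⬝ᵥ (Matrix.diagonal γb * C * A).mulVec x ≤ euclNorm u * (lam2 * μ) := by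
    refine (dotProduct_le_euclNorm_mul _ _).trans ?_
    rw [euclNorm_neg]
    exact mul_le_mul_of_nonneg_left
      ((hlam2 x).trans (mul_le_mul_of_nonneg_left hx hlam2nonneg)) (euclNorm_nonneg u)
  have hω : lam1 * (c - 2 * μ * lam2 / lam1) = lam1 * c - 2 * μ * lam2 := by
    field_simp
  rw [hω]
  have h1 : c * (lam1 * c - 2 * μ * lam2) ≤ euclNorm u * (lam1 * euclNorm u - 2 * μ * lam2) :=
    mul_le_mul hcu (by gcongr) (by linarith) (euclNorm_nonneg u)
  linarith

/-- Proposition 2: properties of the auxiliary function `W`. -/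
theorem stmt11 {n p : ℕ} (A : Matrix (Fin n) (Fin n) ℝ) (B : Matrix (Fin n) (Fin p) ℝ)
    (C : Matrix (Fin p) (Fin n) ℝ) (ψ : Fin p → ℝ → ℝ)
    (γb : Fin p → ℝ) (lam1 lam2 ν c : ℝ)
    -- Assumption 1
    (hA1 : ∀ i, PiecewiseContinuous (ψ i) ∧ ∃ z : ℝ, Sector (ψ i) z)
    -- Assumption 3 (i): Γ̄CB + (CB)ᵀΓ̄ positive definite, Γ̄ positive diagonal
    (hγb : ∀ i, 0 < γb i)
    (hpd : ∀ u : Fin p → ℝ, u ≠ 0 →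
      0 < u ⬝ᵥ ((Matrix.diagonal γb * (C * B) + (C * B)ᵀ * Matrix.diagonal γb).mulVec u))
    -- Assumption 3 (iii): discontinuity at the origin with sign-definite limits
    (hdisc : ∀ i, ¬ ContinuousAt (ψ i) 0 ∧
      (∃ L : ℝ, 0 < L ∧ Tendsto (ψ i) (nhdsWithin 0 (Set.Ioi 0)) (nhds L)) ∧
      (∃ L : ℝ, L < 0 ∧ Tendsto (ψ i) (nhdsWithin 0 (Set.Iio 0)) (nhds L)))
    -- λ₁ is the smallest eigenvalue of Γ̄CB + (CB)ᵀΓ̄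
    (hlam1pos : 0 < lam1)
    (hlam1 : ∀ u : Fin p → ℝ,
      lam1 * (u ⬝ᵥ u) ≤
        u ⬝ᵥ ((Matrix.diagonal γb * (C * B) + (C * B)ᵀ * Matrix.diagonal γb).mulVec u))
    (hlam1min : ∃ u : Fin p → ℝ, u ≠ 0 ∧
      u ⬝ᵥ ((Matrix.diagonal γb * (C * B) + (C * B)ᵀ * Matrix.diagonal γb).mulVec u)
        = lam1 * (u ⬝ᵥ u))
    -- λ₂ is the spectral norm of Γ̄CA
    (hlam2nonneg : 0 ≤ lam2)
    (hlam2 : ∀ v : Fin n → ℝ,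
      euclNorm ((Matrix.diagonal γb * C * A).mulVec v) ≤ lam2 * euclNorm v)
    (hlam2min : ∀ μ' : ℝ, 0 ≤ μ' →
      (∀ v : Fin n → ℝ,
        euclNorm ((Matrix.diagonal γb * C * A).mulVec v) ≤ μ' * euclNorm v) →
      lam2 ≤ μ')
    -- ν, c as in Lemma 3
    (hν : 0 < ν) (hc : 0 < c)
    (hcb : ∀ y : Fin p → ℝ, 0 < euclNorm y → euclNorm y ≤ ν →
      ∀ u : Fin p → ℝ, (fun i => -u i) ∈ PsiSet ψ y → c ≤ euclNorm u) :
    ∃ μ : ℝ, 0 < μ ∧ μ ≤ ν ∧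
      0 < lam1 * (c - 2 * μ * lam2 / lam1) ∧
      ∃ α₄ α₅ : ℝ → ℝ, ClassKInf α₄ ∧ ClassKInf α₅ ∧
        (∀ x : Fin n → ℝ, euclNorm x ≤ μ →
          α₄ (euclNorm (C.mulVec x)) ≤ Wfun γb ψ (C.mulVec x) ∧
            Wfun γb ψ (C.mulVec x) ≤ α₅ (euclNorm (C.mulVec x))) ∧
        (∀ x : Fin n → ℝ, euclNorm x ≤ μ → C.mulVec x ≠ 0 →
          ∀ a ∈ lieDerivW A B C ψ γb x,
            a ≤ -(c * (lam1 * (c - 2 * μ * lam2 / lam1)))) := by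
  obtain ⟨k, K, d, hk, hK, hd, hW⟩ := exists_linear_bounds_Wfun hγb fun i =>
    exists_linear_bounds_integral (hA1 i).1 (hdisc i).2.1 (hdisc i).2.2
  set R : ℝ := ∑ i, ∑ j, |C i j|
  have hR : 0 ≤ R := Finset.sum_nonneg fun i _ => Finset.sum_nonneg fun j _ => abs_nonneg _
  have hsmall : ∀ {g : ℝ → ℝ} {b : ℝ}, Continuous g → g 0 = 0 → 0 < b →
      ∀ᶠ t in nhdsWithin (0:ℝ) (Set.Ioi 0), g t < b := fun {g b} hg h0 hb =>
    (hg.continuousWithinAt.tendsto).eventually (gt_mem_nhds (by rwa [h0]))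
  obtain ⟨μ, hμ0, hμν, hμc, hμR⟩ := (Filter.Eventually.and
    (self_mem_nhdsWithin (a := (0:ℝ)) (s := Set.Ioi 0)) <|
    (hsmall continuous_id rfl hν).and <|
    (hsmall (g := fun t => 2 * t * lam2) (by fun_prop) (by simp) (mul_pos hlam1pos hc)).and
    (hsmall (g := fun t => R * t) (by fun_prop) (by simp) (lt_min hν hd))).exists
  have hCx : ∀ x : Fin n → ℝ, euclNorm x ≤ μ → euclNorm (C.mulVec x) ≤ min ν d := fun x hx =>
    (euclNorm_mulVec_le C x).trans ((mul_le_mul_of_nonneg_left hx hR).trans hμR.le)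
  refine ⟨μ, hμ0, hμν.le, ?_, fun r => k * r, fun r => K * r, classKInf_const_mul hk,
    classKInf_const_mul hK, fun x hx => hW _ ((hCx x hx).trans (min_le_right _ _)),
    fun x hx hne a ha => le_of_mem_lieDerivW hlam1pos hlam1 hlam2nonneg hlam2 hμc hx
      (hcb _ (euclNorm_pos hne) ((hCx x hx).trans (min_le_left _ _))) ha⟩
  rw [mul_sub, mul_div_cancel₀ _ hlam1pos.ne']
  linarith
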